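/- arXiv:1205.6762 — 2 statements merged into one kernel-verified Lean document; each statement's English description precedes it below -/
import Mathlib

section
/- Let L be a field, m, s ≥ 1, σ₁,…,σ_m pairwise commuting injective ring endomorphisms of L, and K a subfield of L with σᵢ(K) ⊆ K. Let η₁,…,η_s ∈ L, and suppose L itself is the smallest subfield of L containing K and η₁,…,η_s and closed under every σᵢ. Let φ(t) = ∑_{i=0}^{m} a_i C(t+i, i) (a_i ∈ ℤ) satisfy φ(r) = trdeg_K K({θ_k(η_j) : ord θ_k ≤ r, 1 ≤ j ≤ s}) for all sufficiently large r ∈ ℕ. Then a_m equals the largest natural number k for which there exist ξ₁,…,ξ_k ∈ L such that the family of all elements θ(ξ_i), where θ ranges over all compositions σ₁^{k₁}∘⋯∘σ_m^{k_m} (k₁,…,k_m ∈ ℕ) and 1 ≤ i ≤ k, is algebraically independent over K. -/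
open Polynomial

set_option synthInstance.maxHeartbeats 1000000
set_option maxHeartbeats 1000000

/-- The binomial polynomial `B_i(t) = (t+i)(t+i−1)⋯(t+1)/i!` in `ℚ[t]`. -/
noncomputable def binomialPoly (i : ℕ) : Polynomial ℚ :=
  Polynomial.C ((i.factorial : ℚ)⁻¹) *
    ∏ j ∈ Finset.range i, (Polynomial.X + Polynomial.C ((j : ℚ) + 1))

/-- Transcendence degree of the `K`-algebra `A`. -/
noncomputable def trdeg (K A : Type*) [CommRing K] [CommRing A] [Algebra K A] : Cardinal :=
  ⨆ s : { s : Set A // AlgebraicIndependent K ((↑) : s → A) }, Cardinal.mk s.1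

/-- `θ_k = σ₁^{k₁} ∘ ⋯ ∘ σ_m^{k_m}` for a family of endomorphisms `σ`. -/
def thetaApply {L : Type*} [Field L] {m : ℕ} (σ : Fin m → (L →+* L))
    (k : Fin m → ℕ) : L → L :=
  (List.ofFn fun i => (⇑(σ i))^[k i]).foldr (· ∘ ·) id

/-- The smallest subfield of `L` containing the subfield `K` and the set `S`
and closed under every endomorphism `σ i`. -/
def diffAdjoin {L : Type*} [Field L] {m : ℕ} (σ : Fin m → (L →+* L))
    (K : Subfield L) (S : Set L) : Subfield L :=
  sInf {F : Subfield L | K ≤ F ∧ S ⊆ ↑F ∧ ∀ i, ∀ x ∈ F, σ i x ∈ F}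


section PolyPart

theorem binomialPoly_eval (m r : ℕ) :
    (binomialPoly m).eval (r : ℚ) = ((r + m).choose m : ℚ) := by
  have h := Nat.ascFactorial_eq_factorial_mul_choose r m
  have h2 : ((r + 1).ascFactorial m : ℚ) = ∏ j ∈ Finset.range m, ((r : ℚ) + ((j : ℚ) + 1)) := by
    rw [Nat.ascFactorial_eq_prod_range]
    push_cast
    exact Finset.prod_congr rfl fun j _ => by ring
  unfold binomialPoly
  rw [eval_mul, eval_C, eval_prod]
  simp only [eval_add, eval_X, eval_C]
  rw [← h2, h]
  push_cast
  rw [← mul_assoc, inv_mul_cancel₀ (by exact_mod_cast Nat.factorial_ne_zero m), one_mul]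

theorem binomialPoly_natDegree (m : ℕ) : (binomialPoly m).natDegree = m := by
  unfold binomialPoly
  rw [natDegree_C_mul (by positivity), natDegree_prod_of_monic _ _ fun j _ => monic_X_add_C _]
  simp only [natDegree_X_add_C, Finset.sum_const, Finset.card_range, smul_eq_mul, mul_one]

theorem binomialPoly_coeff (m : ℕ) : (binomialPoly m).coeff m = ((m.factorial : ℚ)⁻¹) := by
  have h : (∏ j ∈ Finset.range m, (X + C ((j : ℚ) + 1))).natDegree = m := by
    rw [natDegree_prod_of_monic _ _ fun j _ => monic_X_add_C _]
    simp only [natDegree_X_add_C, Finset.sum_const, Finset.card_range, smul_eq_mul, mul_one]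
  have h2 : (∏ j ∈ Finset.range m, (X + C ((j : ℚ) + 1))).Monic :=
    monic_prod_of_monic _ _ fun j _ => monic_X_add_C _
  unfold binomialPoly
  rw [coeff_C_mul]
  have := h2.coeff_natDegree
  rw [h] at this
  rw [this, mul_one]

theorem coeff_le_of_eventually_le {m : ℕ} (hm : 1 ≤ m) (P Q : ℚ[X]) (hP : P.natDegree ≤ m)
    (hQ : Q.natDegree ≤ m) (N : ℕ) (h : ∀ r : ℕ, N ≤ r → P.eval (r : ℚ) ≤ Q.eval (r : ℚ)) :
    P.coeff m ≤ Q.coeff m := by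
  by_contra! hlt
  have hc : (Q - P).coeff m < 0 := by rw [coeff_sub]; linarith
  have hd : (Q - P).natDegree = m :=
    le_antisymm ((natDegree_sub_le_of_le hQ hP).trans (max_self m).le) (le_natDegree_of_ne_zero hc.ne)
  have hlc : (Q - P).leadingCoeff ≤ 0 := by rw [leadingCoeff, hd]; exact hc.le
  have ht := (Polynomial.tendsto_atBot_of_leadingCoeff_nonpos (Q - P)
    (natDegree_pos_iff_degree_pos.mp (by omega)) hlc).comp
    (tendsto_natCast_atTop_atTop (R := ℚ))
  obtain ⟨r, hr1, hr2⟩ := ((ht.eventually (Filter.eventually_lt_atBot 0)).and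
    (Filter.eventually_ge_atTop N)).exists
  have := h r hr2
  simp at hr1
  linarith

theorem phi_facts {m : ℕ} (a : Fin (m + 1) → ℤ) (φ : ℚ[X])
    (hφ : φ = ∑ i : Fin (m + 1), (a i : ℚ) • binomialPoly (i : ℕ)) :
    φ.natDegree ≤ m ∧ φ.coeff m = (a (Fin.last m) : ℚ) * ((m.factorial : ℚ)⁻¹) := by
  constructor
  · rw [hφ]
    refine natDegree_sum_le_of_forall_le _ _ fun i _ => ?_
    refine (natDegree_smul_le _ _).trans ?_
    rw [binomialPoly_natDegree]; omega
  · rw [hφ, finsetSum_coeff, Finset.sum_eq_single (Fin.last m)]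
    · simp [binomialPoly_coeff]
    · intro i _ hi
      rw [coeff_smul, coeff_eq_zero_of_natDegree_lt, smul_zero]
      rw [binomialPoly_natDegree]
      exact Fin.val_lt_last hi
    · simp

/-- Lattice points of the standard simplex of size `r`. -/
def simplexFinset (m r : ℕ) : Finset (Fin m → ℕ) :=
  (Fintype.piFinset fun _ => Finset.range (r + 1)).filter fun v => ∑ i, v i ≤ r

theorem mem_simplexFinset {m r : ℕ} {v : Fin m → ℕ} :
    v ∈ simplexFinset m r ↔ ∑ i, v i ≤ r := by
  simp only [simplexFinset, Finset.mem_filter, Fintype.mem_piFinset, Finset.mem_range,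
    and_iff_right_iff_imp]
  intro h i
  have := Finset.single_le_sum (f := v) (fun _ _ => Nat.zero_le _) (Finset.mem_univ i)
  omega

theorem card_simplexFinset (m r : ℕ) : (simplexFinset m r).card = (r + m).choose m := by
  have h := Finset.card_finsuppAntidiag_nat_eq_choose (s := (Finset.univ : Finset (Fin (m + 1)))) r
  have e : (simplexFinset m r).card =
      ((Finset.univ : Finset (Fin (m + 1))).finsuppAntidiag r).card := by
    refine Finset.card_bij' (fun v _ => Finsupp.equivFunOnFinite.symm
      (Fin.cons (r - ∑ i, v i) v : Fin (m + 1) → ℕ)) (fun f _ => Fin.tail (f : Fin (m + 1) → ℕ))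
      ?_ ?_ ?_ ?_
    · intro v hv
      rw [mem_simplexFinset] at hv
      simp [Finset.mem_finsuppAntidiag, Fin.sum_univ_succ]
      omega
    · intro f hf
      rw [mem_simplexFinset]
      simp [Finset.mem_finsuppAntidiag, Fin.sum_univ_succ] at hf
      simp only [Fin.tail]
      omega
    · intro v hv
      ext i
      simp [Fin.tail]
    · intro f hf
      simp [Finset.mem_finsuppAntidiag, Fin.sum_univ_succ] at hf
      ext i
      refine Fin.cases ?_ (fun i => ?_) i
      · simp only [Finsupp.equivFunOnFinite_symm_apply_apply, Fin.cons_zero, Fin.tail]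
        omega
      · simp [Fin.tail]
  rw [e, h]
  simp only [Finset.card_univ, Fintype.card_fin]
  rw [show m + 1 + r - 1 = r + m by omega]
  exact Nat.choose_symm_add

theorem card_slab (m r : ℕ) (i : Fin m) (c : ℕ) :
    ((simplexFinset m r).filter fun v => v i < c).card ≤ c * (r + 1) ^ (m - 1) := by
  classical
  have hsub : ((simplexFinset m r).filter fun v => v i < c) ⊆
      Fintype.piFinset (Function.update (fun _ => Finset.range (r + 1)) i (Finset.range c)) := by
    intro v hv
    rw [Finset.mem_filter, mem_simplexFinset] at hv
    rw [Fintype.mem_piFinset]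
    intro j
    have := Finset.single_le_sum (f := v) (fun _ _ => Nat.zero_le _) (Finset.mem_univ j)
    by_cases hj : j = i
    · subst hj; simpa using hv.2
    · simp [hj]; omega
  refine (Finset.card_le_card hsub).trans ?_
  rw [Fintype.card_piFinset]
  rw [← Finset.mul_prod_erase _ _ (Finset.mem_univ i)]
  rw [Finset.prod_congr rfl (g := fun _ => r + 1)]
  · simp
  · intro j hj
    simp [Finset.ne_of_mem_erase hj]

open Classical in
theorem card_not_ge (m r : ℕ) (u : Fin m → ℕ) :
    ((simplexFinset m r).filter fun v => ¬ u ≤ v).card ≤ (∑ i, u i) * (r + 1) ^ (m - 1) := by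
  classical
  rw [Finset.sum_mul]
  refine le_trans ?_ (Finset.sum_le_sum fun i _ => card_slab m r i (u i))
  refine le_trans (Finset.card_le_card ?_) Finset.card_biUnion_le
  intro v hv
  rw [Finset.mem_filter] at hv
  obtain ⟨hv, hu⟩ := hv
  rw [Pi.le_def] at hu
  push Not at hu
  obtain ⟨i, hi⟩ := hu
  simp only [Finset.mem_biUnion, Finset.mem_filter]
  exact ⟨i, Finset.mem_univ i, hv, hi⟩

end PolyPart

section AlgPart

variable {F L : Type*} [Field F] [Field L] [Algebra F L]

theorem isAlgebraic_of_mem_field_adjoin (S T : Set L)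
    (h : ∀ x ∈ S, IsAlgebraic (Algebra.adjoin F T) x) (x : L)
    (hx : x ∈ IntermediateField.adjoin F S) : IsAlgebraic (Algebra.adjoin F T) x := by
  induction hx using IntermediateField.adjoin_induction with
  | mem x hx => exact h x hx
  | algebraMap y =>
    exact isAlgebraic_algebraMap (algebraMap F (Algebra.adjoin F T) y)
  | add x y _ _ hx hy => exact hx.add hy
  | inv x _ hx => exact hx.inv
  | mul x y _ _ hx hy => exact hx.mul hy

theorem trdeg_field_adjoin_le (S T : Set L) (hT : T.Finite)
    (h : ∀ x ∈ S, IsAlgebraic (Algebra.adjoin F T) x) :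
    trdeg F (IntermediateField.adjoin F S) ≤ (T.ncard : Cardinal) := by
  unfold trdeg
  refine ciSup_le' fun I => ?_
  obtain ⟨I, hI⟩ := I
  have hJ : AlgebraicIndependent F ((↑) : (Subtype.val '' I : Set L) → L) := by
    have h1 : AlgebraicIndependent F (fun i : I => ((i : IntermediateField.adjoin F S) : L)) :=
      hI.map' (f := (IntermediateField.adjoin F S).val) Subtype.val_injective
    have h2 := h1.coe_range
    rwa [← Set.image_eq_range] at h2
  have hJ' : (AlgebraicIndependent.matroid F L).Indep (Subtype.val '' I : Set L) :=
    AlgebraicIndependent.matroid_indep_iff.mpr hJ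
  have hsub : (Subtype.val '' I : Set L) ⊆ (AlgebraicIndependent.matroid F L).closure T := by
    rw [AlgebraicIndependent.matroid_closure_eq]
    rintro _ ⟨y, _, rfl⟩
    exact isAlgebraic_of_mem_field_adjoin S T h _ y.2
  have hle := hJ'.encard_le_eRk_of_subset hsub
  rw [Matroid.eRk_closure_eq] at hle
  have hle2 := hle.trans (Matroid.eRk_le_encard _ T)
  rw [Set.InjOn.encard_image Subtype.val_injective.injOn, ← hT.cast_ncard_eq] at hle2
  have hfin : I.Finite := Set.finite_of_encard_le_coe hle2
  rw [← hfin.cast_ncard_eq] at hle2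
  rw [← Set.cast_ncard hfin]
  exact_mod_cast hle2

theorem card_le_of_indep {ι : Type} [Fintype ι] (V : IntermediateField F L) (y : ι → L)
    (hy : AlgebraicIndependent F y) (hV : ∀ i, y i ∈ V) (d : ℕ)
    (hd : trdeg F V = (d : Cardinal)) : Fintype.card ι ≤ d := by
  have h1 : AlgebraicIndependent F (fun i => (⟨y i, hV i⟩ : V)) :=
    (AlgHom.algebraicIndependent_iff V.val Subtype.val_injective).mp hy
  have h2 := h1.lift_cardinalMk_le_trdeg
  have h3 : Algebra.trdeg F V = (d : Cardinal) := hd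
  rw [h3] at h2
  simpa using h2

variable {ι κ : Type*} [LinearOrder κ] (key : ι → κ) (x : ι → L)

variable (F) in
/-- Indices whose value is transcendental over the earlier ones. -/
def leadSet : Set ι :=
  {p | Transcendental (Algebra.adjoin F (x '' {q | key q < key p})) (x p)}

theorem isAlgebraic_mono {S T : Set L} (h : S ⊆ T) {a : L}
    (ha : IsAlgebraic (Algebra.adjoin F S) a) : IsAlgebraic (Algebra.adjoin F T) a :=
  ha.adjoin_of_forall_isAlgebraic fun _ hx => (hx.2 (h hx.1)).elim

theorem leadSet_indep (hkey : Function.Injective key) :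
    AlgebraicIndependent F (fun p : leadSet F key x => x p) := by
  classical
  have hfin : ∀ t : Finset ι, (t : Set ι) ⊆ leadSet F key x → AlgebraicIndepOn F x (t : Set ι) := by
    intro t
    induction t using Finset.induction_on_max_value key with
    | empty =>
      intro _
      rw [Finset.coe_empty]
      exact algebraicIndependent_empty_type_iff.mpr (algebraMap F L).injective
    | insert p t hp hmax ih =>
      intro hsub
      rw [Finset.coe_insert] at hsub ⊢
      refine AlgebraicIndepOn.insert (ih fun q hq => hsub (Set.mem_insert_of_mem _ hq)) ?_
      intro halg
      refine hsub (Set.mem_insert _ _) (isAlgebraic_mono (Set.image_mono ?_) halg)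
      intro q hq
      refine lt_of_le_of_ne (hmax q hq) fun h => hp ?_
      rw [← hkey h]; exact hq
  refine algebraicIndependent_of_finite_type fun t ht => ?_
  have := hfin (ht.image Subtype.val).toFinset (by
    intro q hq
    simp only [Set.Finite.coe_toFinset] at hq
    obtain ⟨y, _, rfl⟩ := hq
    exact y.2)
  exact this.comp (fun i : t => (⟨i.1.1, by simp⟩ : {p // p ∈ (((ht.image Subtype.val).toFinset : Finset ι) : Set ι)})) (fun i j h => by
    apply Subtype.ext; apply Subtype.ext; simpa using h)

theorem leadSet_spans [WellFoundedLT κ] (p : ι) :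
    IsAlgebraic (Algebra.adjoin F (x '' {q | q ∈ leadSet F key x ∧ key q ≤ key p})) (x p) := by
  induction hk : key p using WellFoundedLT.induction generalizing p with
  | ind k ih =>
  subst hk
  by_cases hp : p ∈ leadSet F key x
  · exact isAlgebraic_algebraMap (⟨x p, Algebra.subset_adjoin ⟨p, ⟨hp, le_rfl⟩, rfl⟩⟩ :
      Algebra.adjoin F (x '' {q | q ∈ leadSet F key x ∧ key q ≤ key p}))
  · have hp' : IsAlgebraic (Algebra.adjoin F (x '' {q | key q < key p})) (x p) :=
      not_not.mp hp
    refine hp'.adjoin_of_forall_isAlgebraic ?_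
    rintro _ ⟨⟨q, hq, rfl⟩, _⟩
    refine isAlgebraic_mono (Set.image_mono ?_) (ih (key q) hq q rfl)
    exact fun q' hq' => ⟨hq'.1, hq'.2.trans (le_of_lt hq)⟩

end AlgPart

section ThetaPart

theorem exists_theta_monoid {N : Type*} [Monoid N] {m : ℕ} (f : Fin m → N)
    (hf : ∀ i j, f i * f j = f j * f i) :
    (∀ u v : Fin m → ℕ, (List.ofFn fun i => f i ^ (u + v) i).prod =
      (List.ofFn fun i => f i ^ u i).prod * (List.ofFn fun i => f i ^ v i).prod) ∧
    (∀ i, (List.ofFn fun j => f j ^ (Pi.single i 1 : Fin m → ℕ) j).prod = f i) := by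
  have hcl : IsMulCommutative (Submonoid.closure (Set.range f)) :=
    Submonoid.isMulCommutative_closure N (by
      rintro _ ⟨i, rfl⟩ _ ⟨j, rfl⟩
      exact hf i j)
  let _ : CommMonoid (Submonoid.closure (Set.range f)) :=
    { (inferInstance : Monoid (Submonoid.closure (Set.range f))) with
      mul_comm := fun a b => hcl.is_comm.comm a b }
  let g : Fin m → Submonoid.closure (Set.range f) :=
    fun i => ⟨f i, Submonoid.subset_closure ⟨i, rfl⟩⟩
  have hg : ∀ u : Fin m → ℕ, (List.ofFn fun i => f i ^ u i).prod =
      ((∏ i, g i ^ u i : Submonoid.closure (Set.range f)) : N) := by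
    intro u
    rw [← List.prod_ofFn]
    rw [← Submonoid.coe_subtype, map_list_prod, List.map_ofFn]
    rfl
  constructor
  · intro u v
    rw [hg, hg, hg, ← Submonoid.coe_mul]
    simp only [Pi.add_apply, pow_add, Finset.prod_mul_distrib]
  · intro i
    rw [hg]
    rw [Finset.prod_eq_single i]
    · simp [g]
    · intro j _ hj
      simp [hj]
    · simp

variable {L : Type*} [Field L] {m : ℕ}

/-- `θ_k` as a ring endomorphism. -/
def thetaHom (σ : Fin m → (L →+* L)) (k : Fin m → ℕ) : L →+* L :=
  (List.ofFn fun i => (σ i) ^ (k i)).prod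

theorem thetaApply_eq (σ : Fin m → (L →+* L)) (k : Fin m → ℕ) :
    thetaApply σ k = thetaHom σ k := by
  unfold thetaApply thetaHom
  induction m with
  | zero => simp
  | succ n ih =>
    rw [List.ofFn_succ, List.ofFn_succ, List.foldr_cons, List.prod_cons]
    rw [ih (fun i => σ i.succ) (fun i => k i.succ)]
    rw [RingHom.coe_mul, RingHom.coe_pow]

theorem thetaHom_mem (σ : Fin m → (L →+* L)) (k : Fin m → ℕ) (F : Set L)
    (hF : ∀ i, ∀ x ∈ F, σ i x ∈ F) (x : L) (hx : x ∈ F) : thetaHom σ k x ∈ F := by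
  let P : Submonoid (L →+* L) :=
    { carrier := {f | ∀ x ∈ F, f x ∈ F}
      mul_mem' := fun {f g} hf hg x hx => hf _ (hg _ hx)
      one_mem' := fun x hx => hx }
  have : thetaHom σ k ∈ P := by
    refine list_prod_mem ?_
    intro f hf
    rw [List.mem_ofFn] at hf
    obtain ⟨i, rfl⟩ := hf
    exact pow_mem (show σ i ∈ P from hF i) _
  exact this x hx

theorem thetaHom_add (σ : Fin m → (L →+* L))
    (hcomm : ∀ i j, (σ i).comp (σ j) = (σ j).comp (σ i)) (u v : Fin m → ℕ) (x : L) :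
    thetaHom σ (u + v) x = thetaHom σ u (thetaHom σ v x) := by
  have := (exists_theta_monoid σ hcomm).1 u v
  exact congrArg (fun f : L →+* L => f x) this

theorem thetaHom_single (σ : Fin m → (L →+* L))
    (hcomm : ∀ i j, (σ i).comp (σ j) = (σ j).comp (σ i)) (i : Fin m) :
    thetaHom σ (Pi.single i 1) = σ i := (exists_theta_monoid σ hcomm).2 i

theorem thetaHom_zero (σ : Fin m → (L →+* L)) (x : L) : thetaHom σ 0 x = x := by
  have : thetaHom σ 0 = 1 := by
    unfold thetaHom
    apply List.prod_eq_one
    intro f hf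
    rw [List.mem_ofFn] at hf
    obtain ⟨i, rfl⟩ := hf
    simp
  rw [this]; rfl

/-- The ranking of the terms `θ_k η_j`: first by order, then lexicographically, then by `j`. -/
def rankKey {m s : ℕ} (p : (Fin m → ℕ) × Fin s) : ℕ ×ₗ (Lex (Fin m → ℕ) ×ₗ Fin s) :=
  toLex (∑ i, p.1 i, toLex (toLex p.1, p.2))

theorem rankKey_injective {m s : ℕ} : Function.Injective (rankKey (m := m) (s := s)) := by
  rintro ⟨u, i⟩ ⟨v, j⟩ h
  simp only [rankKey, toLex_inj, Prod.mk.injEq] at h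
  exact Prod.ext h.2.1 h.2.2

theorem rankKey_shift {m s : ℕ} (p q : (Fin m → ℕ) × Fin s) (w : Fin m → ℕ)
    (h : rankKey q < rankKey p) :
    rankKey (w + q.1, q.2) < rankKey (w + p.1, p.2) := by
  simp only [rankKey, Prod.Lex.toLex_lt_toLex, Pi.add_apply, Finset.sum_add_distrib, toLex_add,
    add_lt_add_iff_left, add_right_inj] at h ⊢
  exact h

theorem rankKey_sum_le {m s : ℕ} (p q : (Fin m → ℕ) × Fin s)
    (h : rankKey q ≤ rankKey p) : ∑ i, q.1 i ≤ ∑ i, p.1 i := by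
  simp only [rankKey, Prod.Lex.toLex_le_toLex] at h
  rcases h with h | h
  · exact h.le
  · exact h.1.le

theorem shift_algebraic (K : Subfield L) (g : L →+* L) (hg : ∀ x ∈ K, g x ∈ K) (S S' : Set L)
    (hS : ∀ x ∈ S, g x ∈ S') (a : L) (ha : IsAlgebraic (Algebra.adjoin K S) a) :
    IsAlgebraic (Algebra.adjoin K S') (g a) := by
  have hmap : ∀ x ∈ Algebra.adjoin K S, g x ∈ Algebra.adjoin K S' := by
    intro x hx
    induction hx using Algebra.adjoin_induction with
    | mem x hx => exact Algebra.subset_adjoin (hS x hx)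
    | algebraMap r => exact algebraMap_mem (Algebra.adjoin K S') (⟨g r, hg r r.2⟩ : K)
    | add x y _ _ hx hy => rw [map_add]; exact add_mem hx hy
    | mul x y _ _ hx hy => rw [map_mul]; exact mul_mem hx hy
  refine IsAlgebraic.ringHom_of_comp_eq
    (g.restrict (Algebra.adjoin K S) (Algebra.adjoin K S') hmap) g ha ?_ ?_
  · intro x y hxy
    apply Subtype.ext
    apply g.injective
    exact congrArg Subtype.val hxy
  · rfl

end ThetaPart

section MainPart

variable {L : Type*} [Field L] {m s : ℕ}

/-- The terms of order at most `r`. -/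
def termSet (σ : Fin m → (L →+* L)) (η : Fin s → L) (r : ℕ) : Set L :=
  {x : L | ∃ k : Fin m → ℕ, (∑ i, k i) ≤ r ∧ ∃ j : Fin s, x = thetaApply σ k (η j)}

theorem termSet_mono (σ : Fin m → (L →+* L)) (η : Fin s → L) {r r' : ℕ} (h : r ≤ r') :
    termSet σ η r ⊆ termSet σ η r' := by
  rintro x ⟨k, hk, hx⟩
  exact ⟨k, hk.trans h, hx⟩

theorem theta_mem_adjoin (σ : Fin m → (L →+* L))
    (hcomm : ∀ i j, (σ i).comp (σ j) = (σ j).comp (σ i))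
    (K : Subfield L) (hK : ∀ i, ∀ x ∈ K, σ i x ∈ K) (η : Fin s → L) (r : ℕ) (w : Fin m → ℕ)
    (x : L) (hx : x ∈ IntermediateField.adjoin K (termSet σ η r)) :
    thetaHom σ w x ∈ IntermediateField.adjoin K (termSet σ η (∑ i, w i + r)) := by
  induction hx using IntermediateField.adjoin_induction with
  | mem x hx =>
    obtain ⟨k, hk, j, rfl⟩ := hx
    refine IntermediateField.subset_adjoin _ _ ⟨w + k, ?_, j, ?_⟩
    · simp only [Pi.add_apply, Finset.sum_add_distrib]; omega
    · rw [thetaApply_eq, thetaApply_eq, thetaHom_add σ hcomm]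
  | algebraMap y =>
    exact IntermediateField.algebraMap_mem _
      (⟨thetaHom σ w y, thetaHom_mem σ w (K : Set L) hK y y.2⟩ : K)
  | add x y _ _ hx hy => rw [map_add]; exact add_mem hx hy
  | inv x _ hx => rw [map_inv₀]; exact inv_mem hx
  | mul x y _ _ hx hy => rw [map_mul]; exact mul_mem hx hy

theorem exists_mem_adjoin (σ : Fin m → (L →+* L))
    (hcomm : ∀ i j, (σ i).comp (σ j) = (σ j).comp (σ i))
    (K : Subfield L) (hK : ∀ i, ∀ x ∈ K, σ i x ∈ K) (η : Fin s → L)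
    (hgen : diffAdjoin σ K (Set.range η) = ⊤) (x : L) :
    ∃ r, x ∈ IntermediateField.adjoin K (termSet σ η r) := by
  let F : Subfield L :=
    { carrier := {x | ∃ r, x ∈ IntermediateField.adjoin K (termSet σ η r)}
      mul_mem' := by
        rintro x y ⟨r, hx⟩ ⟨r', hy⟩
        exact ⟨max r r', mul_mem
          (IntermediateField.adjoin.mono _ _ _ (termSet_mono σ η (le_max_left r r')) hx)
          (IntermediateField.adjoin.mono _ _ _ (termSet_mono σ η (le_max_right r r')) hy)⟩
      add_mem' := by
        rintro x y ⟨r, hx⟩ ⟨r', hy⟩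
        exact ⟨max r r', add_mem
          (IntermediateField.adjoin.mono _ _ _ (termSet_mono σ η (le_max_left r r')) hx)
          (IntermediateField.adjoin.mono _ _ _ (termSet_mono σ η (le_max_right r r')) hy)⟩
      one_mem' := ⟨0, one_mem _⟩
      zero_mem' := ⟨0, zero_mem _⟩
      neg_mem' := by
        rintro x ⟨r, hx⟩
        exact ⟨r, neg_mem hx⟩
      inv_mem' := by
        rintro x ⟨r, hx⟩
        exact ⟨r, inv_mem hx⟩ }
  have hF : diffAdjoin σ K (Set.range η) ≤ F := by
    refine sInf_le ⟨?_, ?_, ?_⟩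
    · intro y hy
      exact ⟨0, IntermediateField.algebraMap_mem _ (⟨y, hy⟩ : K)⟩
    · rintro _ ⟨j, rfl⟩
      refine ⟨0, IntermediateField.subset_adjoin _ _ ⟨0, by simp, j, ?_⟩⟩
      rw [thetaApply_eq, thetaHom_zero]
    · rintro i y ⟨r, hy⟩
      have := theta_mem_adjoin σ hcomm K hK η r (Pi.single i 1) y hy
      rw [thetaHom_single σ hcomm] at this
      exact ⟨_, this⟩
  rw [hgen] at hF
  exact hF (Subfield.mem_top x)

theorem upper_bound (hm : 1 ≤ m) (σ : Fin m → (L →+* L))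
    (hcomm : ∀ i j, (σ i).comp (σ j) = (σ j).comp (σ i))
    (K : Subfield L) (hK : ∀ i, ∀ x ∈ K, σ i x ∈ K) (η : Fin s → L)
    (hgen : diffAdjoin σ K (Set.range η) = ⊤)
    (φ : Polynomial ℚ) (a : Fin (m + 1) → ℤ)
    (hφ : φ = ∑ i : Fin (m + 1), (a i : ℚ) • binomialPoly (i : ℕ)) (N : ℕ)
    (hval : ∀ r : ℕ, N ≤ r → ∃ d : ℕ,
      trdeg ↥K ↥(IntermediateField.adjoin ↥K (termSet σ η r)) = (d : Cardinal) ∧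
      φ.eval (r : ℚ) = (d : ℚ)) (k : ℕ) (ξ : Fin k → L)
    (hξ : AlgebraicIndependent K
      (fun p : (Fin m → ℕ) × Fin k => thetaApply σ p.1 (ξ p.2))) :
    (k : ℤ) ≤ a (Fin.last m) := by
  choose ρ hρ using fun i => exists_mem_adjoin σ hcomm K hK η hgen (ξ i)
  set R := ∑ i, ρ i with hR
  have hρ' : ∀ i, ξ i ∈ IntermediateField.adjoin K (termSet σ η R) := fun i =>
    IntermediateField.adjoin.mono _ _ _ (termSet_mono σ η
      (Finset.single_le_sum (f := ρ) (fun _ _ => Nat.zero_le _) (Finset.mem_univ i))) (hρ i)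
  have key : ∀ r : ℕ, N + R ≤ r →
      (C (k : ℚ) * taylor (-(R : ℚ)) (binomialPoly m)).eval (r : ℚ) ≤ φ.eval (r : ℚ) := by
    intro r hr
    obtain ⟨d, hd, hd2⟩ := hval r (by omega)
    have hle := card_le_of_indep (ι := simplexFinset m (r - R) × Fin k)
      (IntermediateField.adjoin K (termSet σ η r)) (fun p => thetaApply σ p.1.1 (ξ p.2))
      (hξ.comp (fun p : simplexFinset m (r - R) × Fin k => ((p.1.1, p.2) : (Fin m → ℕ) × Fin k))
        (by
          rintro ⟨⟨u, hu⟩, i⟩ ⟨⟨v, hv⟩, j⟩ h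
          simp only [Prod.mk.injEq] at h
          obtain ⟨rfl, rfl⟩ := h
          rfl))
      (by
        rintro ⟨⟨u, hu⟩, i⟩
        rw [mem_simplexFinset] at hu
        rw [thetaApply_eq]
        exact IntermediateField.adjoin.mono _ _ _ (termSet_mono σ η (by omega))
          (theta_mem_adjoin σ hcomm K hK η R u _ (hρ' i))) d hd
    rw [Fintype.card_prod, Fintype.card_coe, card_simplexFinset, Fintype.card_fin] at hle
    rw [hd2, eval_mul, eval_C, taylor_eval,
      show (r : ℚ) + -(R : ℚ) = ((r - R : ℕ) : ℚ) by
        rw [Nat.cast_sub (by omega)]; ring, binomialPoly_eval]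
    rw [mul_comm]
    exact_mod_cast hle
  have hdeg : (taylor (-(R : ℚ)) (binomialPoly m)).natDegree = m := by
    rw [natDegree_taylor, binomialPoly_natDegree]
  obtain ⟨hφd, hφc⟩ := phi_facts a φ hφ
  have := coeff_le_of_eventually_le hm _ φ
    ((natDegree_C_mul_le _ _).trans hdeg.le) hφd _ key
  have hc : (taylor (-(R : ℚ)) (binomialPoly m)).coeff m = ((m.factorial : ℚ)⁻¹) := by
    have h1 := coeff_taylor_natDegree (r := -(R : ℚ)) (f := binomialPoly m)
    rw [leadingCoeff, binomialPoly_natDegree, binomialPoly_coeff] at h1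
    exact h1
  rw [coeff_C_mul, hc, hφc] at this
  have hpos : (0 : ℚ) < (m.factorial : ℚ)⁻¹ := by positivity
  have := le_of_mul_le_mul_right this hpos
  exact_mod_cast this

open Classical in
theorem lower_bound (hm : 1 ≤ m) (σ : Fin m → (L →+* L))
    (hcomm : ∀ i j, (σ i).comp (σ j) = (σ j).comp (σ i))
    (K : Subfield L) (hK : ∀ i, ∀ x ∈ K, σ i x ∈ K) (η : Fin s → L)
    (φ : Polynomial ℚ) (a : Fin (m + 1) → ℤ)
    (hφ : φ = ∑ i : Fin (m + 1), (a i : ℚ) • binomialPoly (i : ℕ)) (N : ℕ)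
    (hval : ∀ r : ℕ, N ≤ r → ∃ d : ℕ,
      trdeg ↥K ↥(IntermediateField.adjoin ↥K (termSet σ η r)) = (d : Cardinal) ∧
      φ.eval (r : ℚ) = (d : ℚ)) :
    ∃ (k : ℕ) (ξ : Fin k → L), AlgebraicIndependent K
      (fun p : (Fin m → ℕ) × Fin k => thetaApply σ p.1 (ξ p.2)) ∧
      a (Fin.last m) ≤ (k : ℤ) := by
  let x : (Fin m → ℕ) × Fin s → L := fun p => thetaApply σ p.1 (η p.2)
  let B : Set ((Fin m → ℕ) × Fin s) := leadSet K rankKey x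
  have hB : AlgebraicIndependent K (fun p : B => x p) := leadSet_indep rankKey x rankKey_injective
  have hshift : ∀ (u w : Fin m → ℕ) (j : Fin s), (w + u, j) ∈ B → (u, j) ∈ B := by
    intro u w j hwu halg
    refine hwu ?_
    have h1 := shift_algebraic K (thetaHom σ w) (fun y hy => thetaHom_mem σ w (K : Set L) hK y hy)
      (x '' {q | rankKey q < rankKey (u, j)}) (x '' {q | rankKey q < rankKey (w + u, j)}) (by
        rintro _ ⟨q, hq, rfl⟩
        refine ⟨(w + q.1, q.2), rankKey_shift (u, j) q w hq, ?_⟩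
        simp only [x, thetaApply_eq, thetaHom_add σ hcomm]) _ halg
    have h2 : thetaHom σ w (x (u, j)) = x (w + u, j) := by
      simp only [x, thetaApply_eq, thetaHom_add σ hcomm]
    rwa [h2] at h1
  let J : Finset (Fin s) := Finset.univ.filter fun j => ∀ v, (v, j) ∈ B
  have hu : ∀ j : Fin s, ∃ u : Fin m → ℕ, j ∉ J → (u, j) ∉ B := by
    intro j
    by_cases hj : j ∈ J
    · exact ⟨0, fun h => (h hj).elim⟩
    · simp only [J, Finset.mem_filter, Finset.mem_univ, true_and, not_forall] at hj
      obtain ⟨u, hu⟩ := hj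
      exact ⟨u, fun _ => hu⟩
  choose u hu using hu
  set c : ℕ := ∑ j, ∑ i, u j i with hc
  have hcount : ∀ r : ℕ, N ≤ r → φ.eval (r : ℚ) ≤
      (C (J.card : ℚ) * binomialPoly m + C ((c : ℚ)) * (X + C 1) ^ (m - 1)).eval (r : ℚ) := by
    intro r hr
    obtain ⟨d, hd, hd2⟩ := hval r hr
    let T : Finset ((Fin m → ℕ) × Fin s) :=
      (simplexFinset m r ×ˢ Finset.univ).filter fun p => p ∈ B
    have hle : (d : Cardinal) ≤ (((x '' (T : Set _)).ncard : ℕ) : Cardinal) := by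
      rw [← hd]
      refine trdeg_field_adjoin_le _ _ (T.finite_toSet.image x) ?_
      rintro _ ⟨v, hv, j, rfl⟩
      refine isAlgebraic_mono (Set.image_mono ?_) (leadSet_spans (F := K) rankKey x (v, j))
      rintro q ⟨hqB, hq⟩
      have := rankKey_sum_le _ _ hq
      simp only [T, Finset.coe_filter, Set.mem_ofPred_eq, Finset.mem_product, Finset.mem_univ,
        and_true, mem_simplexFinset]
      exact ⟨this.trans hv, hqB⟩
    have hle2 : d ≤ (x '' (T : Set _)).ncard := by exact_mod_cast hle
    have hle3 : d ≤ T.card := by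
      refine hle2.trans ((Set.ncard_image_le T.finite_toSet).trans ?_)
      rw [Set.ncard_coe_finset]
    have hT : T.card = ∑ j, ((simplexFinset m r).filter fun v => (v, j) ∈ B).card := by
      rw [Finset.card_filter, Finset.sum_product_right]
      exact Finset.sum_congr rfl fun j _ => by rw [Finset.card_filter]
    have hj : ∀ j : Fin s, ((simplexFinset m r).filter fun v => (v, j) ∈ B).card ≤
        (if j ∈ J then (r + m).choose m else 0) + (∑ i, u j i) * (r + 1) ^ (m - 1) := by
      intro j
      split_ifs with h
      · refine (Finset.card_filter_le _ _).trans ?_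
        rw [card_simplexFinset]; exact Nat.le_add_right _ _
      · rw [zero_add]
        refine le_trans (Finset.card_le_card ?_) (card_not_ge m r (u j))
        intro v hv
        rw [Finset.mem_filter] at hv ⊢
        refine ⟨hv.1, fun huv => hu j h (hshift (u j) (v - u j) j ?_)⟩
        rw [tsub_add_cancel_of_le huv]
        exact hv.2
    have hfin : d ≤ J.card * (r + m).choose m + c * (r + 1) ^ (m - 1) := by
      refine hle3.trans ?_
      rw [hT]
      refine (Finset.sum_le_sum fun j _ => hj j).trans ?_
      rw [Finset.sum_add_distrib, ← Finset.sum_mul, ← Finset.sum_filter]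
      simp [hc]
    rw [hd2, eval_add, eval_mul, eval_mul, eval_C, eval_C, binomialPoly_eval, eval_pow, eval_add,
      eval_X, eval_C]
    exact_mod_cast hfin
  obtain ⟨hφd, hφc⟩ := phi_facts a φ hφ
  have hd1 : (C (J.card : ℚ) * binomialPoly m).natDegree ≤ m :=
    (natDegree_C_mul_le _ _).trans (binomialPoly_natDegree m).le
  have hd2 : (C ((c : ℚ)) * (X + C 1) ^ (m - 1)).natDegree ≤ m - 1 := by
    refine (natDegree_C_mul_le _ _).trans ?_
    rw [natDegree_pow, natDegree_X_add_C, mul_one]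
  have hmain := coeff_le_of_eventually_le hm φ _ hφd
    (natDegree_add_le_of_degree_le hd1 (hd2.trans (Nat.sub_le _ _))) N hcount
  rw [coeff_add, coeff_C_mul, binomialPoly_coeff, hφc,
    coeff_eq_zero_of_natDegree_lt (lt_of_le_of_lt hd2 (by omega)), add_zero] at hmain
  have hpos : (0 : ℚ) < (m.factorial : ℚ)⁻¹ := by positivity
  have hmain := le_of_mul_le_mul_right hmain hpos
  refine ⟨J.card, fun i => η (J.equivFin.symm i), ?_, by exact_mod_cast hmain⟩
  refine hB.comp (fun p : (Fin m → ℕ) × Fin J.card =>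
    (⟨(p.1, (J.equivFin.symm p.2 : Fin s)), ?_⟩ : B)) ?_
  · exact (Finset.mem_filter.mp (J.equivFin.symm p.2).2).2 p.1
  · rintro ⟨v, i⟩ ⟨w, j⟩ h
    simp only [Subtype.mk.injEq, Prod.mk.injEq] at h
    obtain ⟨rfl, h⟩ := h
    have := J.equivFin.symm.injective (Subtype.ext h)
    rw [this]

end MainPart

/-- Theorem III.3(iii): the coefficient `a_m` of the difference dimension
polynomial of `L = K⟨η₁,…,η_s⟩` equals the difference transcendence degree of
`L` over `K`, i.e., the largest `k` such that there exist `ξ₁,…,ξ_k ∈ L` whose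
full family of transforms `θ(ξ_i)` is algebraically independent over `K`. -/
theorem difference_dimension_polynomial_top_coeff
    (L : Type*) [Field L] (m s : ℕ) (hm : 1 ≤ m) (hs : 1 ≤ s)
    (σ : Fin m → (L →+* L))
    (hinj : ∀ i, Function.Injective (σ i))
    (hcomm : ∀ i j, (σ i).comp (σ j) = (σ j).comp (σ i))
    (K : Subfield L) (hK : ∀ i, ∀ x ∈ K, σ i x ∈ K)
    (η : Fin s → L)
    (hgen : diffAdjoin σ K (Set.range η) = ⊤)
    (φ : Polynomial ℚ) (a : Fin (m + 1) → ℤ)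
    (hφ : φ = ∑ i : Fin (m + 1), (a i : ℚ) • binomialPoly (i : ℕ))
    (hval : ∃ N : ℕ, ∀ r : ℕ, N ≤ r → ∃ d : ℕ,
      trdeg ↥K ↥(IntermediateField.adjoin ↥K
          {x : L | ∃ k : Fin m → ℕ, (∑ i, k i) ≤ r ∧
            ∃ j : Fin s, x = thetaApply σ k (η j)}) = (d : Cardinal) ∧
      φ.eval (r : ℚ) = (d : ℚ)) :
    ∃ k0 : ℕ, a (Fin.last m) = (k0 : ℤ) ∧
      IsGreatest {k : ℕ | ∃ ξ : Fin k → L,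
        AlgebraicIndependent ↥K
          (fun p : (Fin m → ℕ) × Fin k => thetaApply σ p.1 (ξ p.2))} k0 := by
  obtain ⟨N, hval⟩ := hval
  obtain ⟨k, ξ, hξ, hle⟩ := lower_bound hm σ hcomm K hK η φ a hφ N hval
  have hub := upper_bound hm σ hcomm K hK η hgen φ a hφ N hval
  have heq : a (Fin.last m) = (k : ℤ) := le_antisymm hle (hub k ξ hξ)
  refine ⟨k, heq, ⟨ξ, hξ⟩, ?_⟩
  rintro k' ⟨ξ', hξ'⟩
  have := hub k' ξ' hξ'
  rw [heq] at this
  exact_mod_cast this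
end

section
/- Let L be a field, m, s ≥ 1, σ₁,…,σ_m pairwise commuting ring automorphisms of L, and K a subfield of L with σᵢ(K) ⊆ K and σᵢ^{−1}(K) ⊆ K for all i. Let η₁,…,η_s ∈ L. Then there exists a polynomial ψ ∈ ℚ[t] with deg ψ ≤ m and an integer a such that ψ(t) = (2^m a / m!) t^m + (terms of degree < m) and, for all sufficiently large r ∈ ℕ, ψ(r) equals the transcendence degree over K of the subfield of L generated over K by the set {σ₁^{k₁}∘⋯∘σ_m^{k_m}(η_j) : k₁,…,k_m ∈ ℤ, |k₁|+⋯+|k_m| ≤ r, 1 ≤ j ≤ s}. -/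
open Polynomial

set_option synthInstance.maxHeartbeats 1000000
set_option maxHeartbeats 1000000

/-- `γ_k = σ₁^{k₁} ∘ ⋯ ∘ σ_m^{k_m}` (integer exponents) for a family of
automorphisms `σ`. -/
def gammaApply {L : Type*} [Field L] {m : ℕ} (σ : Fin m → RingAut L)
    (k : Fin m → ℤ) : L → L :=
  (List.ofFn fun i => ⇑(σ i ^ k i)).foldr (· ∘ ·) id


/-- Eventually `Δ^m f = c`. -/
def EP (m : ℕ) (c : ℤ) (f : ℕ → ℤ) : Prop :=
  ∃ N, ∀ r, N ≤ r → (fwdDiff 1)^[m] f r = c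

lemma EP.zero_iff {c : ℤ} {f : ℕ → ℤ} : EP 0 c f ↔ ∃ N, ∀ r, N ≤ r → f r = c := Iff.rfl

lemma EP.succ_iff {m : ℕ} {c : ℤ} {f : ℕ → ℤ} :
    EP (m+1) c f ↔ EP m c (fun r => f (r+1) - f r) := Iff.rfl

lemma EP.congr {m : ℕ} {c : ℤ} {f g : ℕ → ℤ} (h : EP m c f) (N : ℕ)
    (hfg : ∀ r, N ≤ r → f r = g r) : EP m c g := by
  induction m generalizing f g with
  | zero =>
    obtain ⟨M, hM⟩ := h
    exact ⟨max M N, fun r hr => by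
      have := hM r (le_trans (le_max_left _ _) hr)
      have h2 := hfg r (le_trans (le_max_right _ _) hr)
      simp only [Function.iterate_zero, id] at this ⊢
      omega⟩
  | succ m ih =>
    rw [EP.succ_iff] at h ⊢
    exact ih h (fun r hr => by rw [hfg r hr, hfg (r+1) (by omega)])

lemma EP.add {m : ℕ} {c d : ℤ} {f g : ℕ → ℤ} (h : EP m c f) (h' : EP m d g) :
    EP m (c + d) (fun r => f r + g r) := by
  obtain ⟨M, hM⟩ := h
  obtain ⟨N, hN⟩ := h'
  refine ⟨max M N, fun r hr => ?_⟩
  have := hM r (le_trans (le_max_left _ _) hr)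
  have h2 := hN r (le_trans (le_max_right _ _) hr)
  have h3 := congrFun (fwdDiff_iter_add (1:ℕ) f g m) r
  have h4 : (f + g) = fun r => f r + g r := rfl
  rw [h4] at h3
  rw [h3, Pi.add_apply, this, h2]

lemma EP.zero (m : ℕ) : EP m 0 (fun _ => 0) := by
  induction m with
  | zero => exact ⟨0, fun r _ => rfl⟩
  | succ m ih => rw [EP.succ_iff]; simpa using ih

lemma EP.neg {m : ℕ} {c : ℤ} {f : ℕ → ℤ} (h : EP m c f) : EP m (-c) (fun r => - f r) := by
  induction m generalizing f with
  | zero =>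
    obtain ⟨N, hN⟩ := h
    exact ⟨N, fun r hr => by simpa using hN r hr⟩
  | succ m ih =>
    rw [EP.succ_iff] at h ⊢
    exact (ih h).congr 0 (fun r _ => by ring)

lemma EP.sum {ι : Type*} (s : Finset ι) {m : ℕ} {c : ι → ℤ} {f : ι → ℕ → ℤ}
    (h : ∀ i ∈ s, EP m (c i) (f i)) : EP m (∑ i ∈ s, c i) (fun r => ∑ i ∈ s, f i r) := by
  classical
  induction s using Finset.induction_on with
  | empty => simpa using EP.zero m
  | insert a s ha ih =>
    simp only [Finset.sum_insert ha]
    exact (h a (by simp)).add (ih fun i hi => h i (by simp [hi]))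

lemma EP.shift {m : ℕ} {c : ℤ} {f : ℕ → ℤ} (d : ℕ) (h : EP m c f) :
    EP m c (fun r => f (r + d)) := by
  induction m generalizing f with
  | zero =>
    obtain ⟨N, hN⟩ := h
    exact ⟨N, fun r hr => hN (r + d) (by omega)⟩
  | succ m ih =>
    rw [EP.succ_iff] at h ⊢
    exact (ih h).congr 0 (fun r _ => by simp only [add_right_comm])

lemma EP.unshift {m : ℕ} {c : ℤ} {f : ℕ → ℤ} (d : ℕ) (h : EP m c (fun r => f (r + d))) :
    EP m c f := by
  induction m generalizing f with
  | zero =>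
    obtain ⟨N, hN⟩ := h
    refine ⟨N + d, fun r hr => ?_⟩
    have := hN (r - d) (by omega)
    simp only [Function.iterate_zero, id] at this ⊢
    rwa [Nat.sub_add_cancel (by omega)] at this
  | succ m ih =>
    rw [EP.succ_iff] at h ⊢
    exact ih (h.congr 0 (fun r _ => by simp only [add_right_comm]))

lemma EP.lift {m : ℕ} {c : ℤ} {f : ℕ → ℤ} (h : EP m c f) : EP (m+1) 0 f := by
  induction m generalizing f with
  | zero =>
    obtain ⟨N, hN⟩ := h
    rw [EP.succ_iff]
    refine ⟨N, fun r hr => ?_⟩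
    have h1 := hN r hr
    have h2 := hN (r+1) (by omega)
    simp only [Function.iterate_zero, id] at h1 h2 ⊢
    omega
  | succ m ih => exact ih h

lemma EP.psum {m : ℕ} {c : ℤ} {f : ℕ → ℤ} (h : EP m c f) :
    EP (m+1) c (fun r => ∑ t ∈ Finset.range (r+1), f t) := by
  rw [EP.succ_iff]
  refine (h.shift 1).congr 0 fun r _ => ?_
  rw [Finset.sum_range_succ _ (r+1)]
  ring

lemma EP.pos {m : ℕ} {c : ℤ} {f : ℕ → ℤ} (h : EP m c f) (hc : 0 < c) :
    ∃ N, ∀ r, N ≤ r → 0 < f r := by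
  induction m generalizing f with
  | zero =>
    obtain ⟨N, hN⟩ := h
    exact ⟨N, fun r hr => by
      have := hN r hr
      simp only [Function.iterate_zero, id] at this
      omega⟩
  | succ m ih =>
    obtain ⟨N, hN⟩ := ih (EP.succ_iff.1 h)
    have key : ∀ d : ℕ, f N + d ≤ f (N + d) := by
      intro d
      induction d with
      | zero => simp
      | succ d ihd =>
        have := hN (N + d) (by omega)
        push_cast
        rw [← add_assoc N]
        omega
    refine ⟨N + ((f N).natAbs + 1), fun r hr => ?_⟩
    have := key (r - N)
    rw [Nat.add_sub_cancel' (by omega)] at this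
    omega

lemma EP.le {m : ℕ} {c d : ℤ} {f g : ℕ → ℤ} (h : EP m c f) (h' : EP m d g)
    (hfg : ∀ r, f r ≤ g r) : c ≤ d := by
  by_contra hlt
  obtain ⟨N, hN⟩ := (h.add h'.neg).pos (by omega)
  have := hN N le_rfl
  have := hfg N
  omega

lemma EP.poly {m : ℕ} {c : ℤ} {f : ℕ → ℤ} (h : EP m c f) :
    ∃ ψ : ℚ[X], ψ.degree ≤ m ∧ ψ.coeff m = (c : ℚ) / (m.factorial : ℚ) ∧
      ∃ N : ℕ, ∀ r : ℕ, N ≤ r → ψ.eval (r : ℚ) = (f r : ℚ) := by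
  obtain ⟨N, hN⟩ := h
  have hz : ∀ k, m < k → (fwdDiff 1)^[k] f N = 0 := by
    have : ∀ k, ∀ r, N ≤ r → (fwdDiff 1)^[m + 1 + k] f r = 0 := by
      intro k
      induction k with
      | zero =>
        intro r hr
        rw [add_zero, Function.iterate_succ_apply', fwdDiff, hN r hr, hN (r+1) (by omega), sub_self]
      | succ k ih =>
        intro r hr
        rw [← add_assoc, Function.iterate_succ_apply', fwdDiff, ih r hr, ih (r+1) (by omega),
          sub_self]
    intro k hk
    obtain ⟨j, rfl⟩ := Nat.exists_eq_add_of_le hk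
    exact this j N le_rfl
  let q : ℕ → ℚ[X] := fun k =>
    C ((((fwdDiff 1)^[k] f N : ℤ) : ℚ) / (k.factorial : ℚ)) * (descPochhammer ℚ k)
  let p : ℚ[X] := ∑ k ∈ Finset.range (m+1), q k
  have hqd : ∀ k, (q k).natDegree ≤ k := fun k =>
    (natDegree_C_mul_le _ _).trans (by rw [descPochhammer_natDegree])
  have hpd : p.natDegree ≤ m := by
    refine natDegree_sum_le_of_forall_le _ _ fun k hk => ?_
    have := hqd k
    simp at hk
    omega
  have hpc : p.coeff m = (c : ℚ) / (m.factorial : ℚ) := by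
    simp only [p, finsetSum_coeff]
    rw [Finset.sum_range_succ, Finset.sum_eq_zero, zero_add]
    · simp only [q, coeff_C_mul, hN N le_rfl]
      have h1 := (monic_descPochhammer ℚ m).coeff_natDegree
      rw [descPochhammer_natDegree] at h1
      rw [h1, mul_one]
    · intro k hk
      have := hqd k
      simp at hk
      exact coeff_eq_zero_of_natDegree_lt (by omega)
  have hpe : ∀ n : ℕ, p.eval (n : ℚ) = (f (N + n) : ℚ) := by
    intro n
    have h1 := shift_eq_sum_fwdDiff_iter (1:ℕ) f n N
    simp only [smul_eq_mul, mul_one] at h1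
    have h2 : ∀ M, n ≤ M → m ≤ M → f (N + n) =
        ∑ k ∈ Finset.range (M + 1), (n.choose k : ℤ) * (fwdDiff 1)^[k] f N := by
      intro M hn _
      rw [h1]
      simp only [nsmul_eq_mul]
      refine Finset.sum_subset (by intro x; simp; omega) fun k _ hk => ?_
      simp at hk
      rw [Nat.choose_eq_zero_of_lt (by omega)]; simp
    have h3 : f (N + n) =
        ∑ k ∈ Finset.range (m + 1), (n.choose k : ℤ) * (fwdDiff 1)^[k] f N := by
      rw [h2 (max n m) (le_max_left _ _) (le_max_right _ _)]
      symm
      refine Finset.sum_subset (by intro x; simp; omega) fun k _ hk => ?_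
      simp at hk
      rw [hz k (by omega)]; simp
    rw [h3]
    simp only [p, eval_finsetSum, q, eval_mul, eval_C]
    push_cast
    refine Finset.sum_congr rfl fun k _ => ?_
    rw [Nat.cast_choose_eq_descPochhammer_div]
    ring
  refine ⟨p.comp (X - C (N:ℚ)), ?_, ?_, N, fun r hr => ?_⟩
  · refine natDegree_le_iff_degree_le.1 ?_
    rw [natDegree_comp, natDegree_X_sub_C, mul_one]
    exact hpd
  · rcases hpd.lt_or_eq with hlt | heq
    · rw [coeff_eq_zero_of_natDegree_lt (by rw [natDegree_comp, natDegree_X_sub_C, mul_one]; exact hlt),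
        ← hpc, coeff_eq_zero_of_natDegree_lt hlt]
    · have hn : (p.comp (X - C (N:ℚ))).natDegree = m := by
        rw [natDegree_comp, natDegree_X_sub_C, mul_one, heq]
      have h5 := leadingCoeff_comp (p := p) (q := X - C (N:ℚ)) (by rw [natDegree_X_sub_C]; exact one_ne_zero)
      rw [leadingCoeff, hn, leadingCoeff, heq] at h5
      rw [h5, hpc, (monic_X_sub_C (N:ℚ)).leadingCoeff, one_pow, mul_one]
  · have := hpe (r - N)
    rw [Nat.add_sub_cancel' hr] at this
    rw [← this, eval_comp]
    simp [Nat.cast_sub hr]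

/-- simplex -/
def box (m r : ℕ) : Finset (Fin m → ℕ) :=
  (Fintype.piFinset fun _ => Finset.range (r+1)).filter fun v => ∑ i, v i ≤ r

lemma mem_box {m r : ℕ} {v : Fin m → ℕ} : v ∈ box m r ↔ ∑ i, v i ≤ r := by
  simp only [box, Finset.mem_filter, Fintype.mem_piFinset, Finset.mem_range, and_iff_right_iff_imp]
  intro h i
  have := Finset.single_le_sum (f := v) (fun i _ => Nat.zero_le _) (Finset.mem_univ i)
  omega

open Classical in
noncomputable def cnt {m : ℕ} (U : Set (Fin m → ℕ)) (r : ℕ) : ℤ :=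
  (((box m r).filter fun v => v ∉ U).card : ℤ)

lemma cnt_succ {m : ℕ} (U : Set (Fin (m+1) → ℕ)) (r : ℕ) :
    cnt U r = ∑ n ∈ Finset.range (r+1), cnt {w : Fin m → ℕ | Fin.cons n w ∈ U} (r - n) := by
  classical
  unfold cnt
  rw [Finset.card_eq_sum_card_fiberwise (f := fun v => v 0) (t := Finset.range (r+1))]
  · push_cast
    refine Finset.sum_congr rfl fun n hn => ?_
    congr 1
    simp at hn
    refine Finset.card_nbij' (fun v => Fin.tail v) (fun w => Fin.cons n w) ?_ ?_ ?_ ?_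
    · intro v hv
      simp only [Finset.coe_filter, Set.mem_ofPred_eq, Finset.mem_filter, mem_box, Fin.sum_univ_succ] at hv ⊢
      obtain ⟨⟨h1, h2⟩, rfl⟩ := hv
      refine ⟨?_, ?_⟩
      · simp only [Fin.tail]; omega
      · rwa [Fin.cons_self_tail]
    · intro w hw
      simp only [Finset.coe_filter, Set.mem_ofPred_eq, Finset.mem_filter, mem_box, Fin.sum_univ_succ] at hw ⊢
      refine ⟨⟨?_, hw.2⟩, ?_⟩
      · simp; omega
      · simp
    · intro v hv
      simp only [Finset.coe_filter, Set.mem_ofPred_eq, Finset.mem_filter] at hv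
      rw [← hv.2]
      exact Fin.cons_self_tail v
    · intro w _
      simp
  · intro v hv
    simp only [Finset.coe_filter, Set.mem_ofPred_eq, mem_box, Fin.sum_univ_succ] at hv
    simp
    omega

open Classical in
lemma cnt_EP {m : ℕ} (U : Set (Fin m → ℕ)) (hU : IsUpperSet U) :
    EP m (if U = ∅ then 1 else 0) (cnt U) := by
  induction m with
  | zero =>
    refine ⟨0, fun r _ => ?_⟩
    simp only [Function.iterate_zero, id, cnt]
    have hb : box 0 r = {0} := by
      ext v; simp [mem_box, Subsingleton.elim v 0]
    rw [hb, Finset.filter_singleton]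
    by_cases h : (0 : Fin 0 → ℕ) ∈ U
    · have : U ≠ ∅ := Set.nonempty_iff_ne_empty.1 ⟨_, h⟩
      rw [if_neg this, if_neg (not_not.2 h)]; rfl
    · have : U = ∅ := by
        ext v; rw [Subsingleton.elim v 0]; exact ⟨fun hh => absurd hh h, fun hh => hh.elim⟩
      rw [if_pos this, if_pos h]; rfl
  | succ m ih =>
    let V : ℕ → Set (Fin m → ℕ) := fun n => {w | Fin.cons n w ∈ U}
    have hV : ∀ n, IsUpperSet (V n) := by
      intro n a b hab ha
      refine hU ?_ ha
      intro i
      refine Fin.cases ?_ (fun i => ?_) i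
      · simp
      · simpa using hab i
    obtain ⟨n0, hn0⟩ : ∃ n0, ∀ n, n0 ≤ n → V n = V n0 := by
      have hfin : {x | Minimal (· ∈ U) x}.Finite :=
        WellQuasiOrderedLE.finite_of_isAntichain (setOfPred_minimal_antichain _)
      obtain ⟨b, hb⟩ := (hfin.image (fun v => v 0)).bddAbove
      refine ⟨b, fun n hn => Set.Subset.antisymm ?_ ?_⟩
      · intro w hw
        obtain ⟨u, hu, hmin⟩ := exists_minimal_le_of_wellFoundedLT (· ∈ U) _ hw
        have hub : u 0 ≤ b := hb ⟨u, hmin, rfl⟩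
        refine hU (a := u) ?_ hmin.1
        intro i
        refine Fin.cases ?_ (fun i => ?_) i
        · simpa using hub
        · simpa using hu i.succ
      · intro w hw
        refine hU ?_ hw
        intro i
        refine Fin.cases ?_ (fun i => ?_) i
        · simpa using hn
        · simp
    have hE : U = ∅ ↔ V n0 = ∅ := by
      constructor
      · intro h; simp [V, h]
      · intro h
        ext v
        simp only [Set.mem_empty_iff_false, iff_false]
        intro hv
        have : Fin.tail v ∈ V (max n0 (v 0)) := by
          refine hU (a := v) ?_ hv
          intro i
          refine Fin.cases ?_ (fun i => ?_) i
          · simp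
          · simp [Fin.tail]
        rw [hn0 _ (le_max_left _ _), h] at this
        exact this
    have h1 : EP (m+1) (∑ n ∈ Finset.range n0, 0)
        (fun r => ∑ n ∈ Finset.range n0, cnt (V n) (r - n)) := by
      refine EP.sum _ fun n _ => ?_
      refine EP.unshift n ?_
      exact (ih (V n) (hV n)).lift.congr 0 fun r _ => by simp
    have h2 : EP (m+1) (if U = ∅ then 1 else 0)
        (fun r => ∑ t ∈ Finset.range (r - n0 + 1), cnt (V n0) t) := by
      refine EP.unshift n0 ?_
      have := (ih (V n0) (hV n0)).psum
      simp only [hE]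
      exact this.congr 0 fun r _ => by simp
    have h3 := h1.add h2
    rw [Finset.sum_const_zero, zero_add] at h3
    refine h3.congr n0 fun r hr => ?_
    rw [cnt_succ]
    obtain ⟨d, rfl⟩ := Nat.exists_eq_add_of_le hr
    rw [show n0 + d - n0 + 1 = d + 1 by omega, add_assoc n0 d 1,
      Finset.sum_range_add (fun n => cnt {w : Fin m → ℕ | Fin.cons n w ∈ U} (n0 + d - n)) n0 (d+1),
      ← Finset.sum_range_reflect (fun t => cnt (V n0) t) (d+1)]
    congr 1
    refine Finset.sum_congr rfl fun t ht => ?_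
    simp at ht
    change _ = cnt (V (n0 + t)) _
    rw [hn0 (n0 + t) (by omega)]
    congr 1
    omega

open Classical in
lemma rk_count {α ι β : Type*} [LinearOrder β] (M : Matroid α) (hE : M.E = Set.univ)
    (x : ι → α) (f : ι → β) (hf : Function.Injective f) (S : Finset ι) :
    M.eRk (x '' (S : Set ι)) =
      ((S.filter fun i => x i ∉ M.closure (x '' {j | j ∈ S ∧ f j < f i})).card : ℕ∞) := by
  induction S using Finset.induction_on_max_value f with
  | empty => simp
  | insert a S ha hmax ih =>
    have h1 : {j | j ∈ insert a S ∧ f j < f a} = (S : Set ι) := by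
      ext j
      simp only [Finset.mem_insert, Set.mem_ofPred_eq, Finset.mem_coe]
      constructor
      · rintro ⟨rfl | h, h2⟩
        · exact absurd h2 (lt_irrefl _)
        · exact h
      · intro h
        exact ⟨Or.inr h, lt_of_le_of_ne (hmax j h) fun e => ha (hf e ▸ h)⟩
    have h2 : (S.filter fun i => x i ∉ M.closure (x '' {j | j ∈ insert a S ∧ f j < f i})) =
        S.filter fun i => x i ∉ M.closure (x '' {j | j ∈ S ∧ f j < f i}) := by
      refine Finset.filter_congr fun i hi => ?_
      have : {j | j ∈ insert a S ∧ f j < f i} = {j | j ∈ S ∧ f j < f i} := by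
        ext j
        simp only [Finset.mem_insert, Set.mem_ofPred_eq]
        constructor
        · rintro ⟨rfl | h, h2⟩
          · exact absurd h2 (not_lt.2 (hmax i hi))
          · exact ⟨h, h2⟩
        · rintro ⟨h, h2⟩
          exact ⟨Or.inr h, h2⟩
      rw [this]
    rw [Finset.filter_insert, h1, h2, Finset.coe_insert, Set.image_insert_eq]
    by_cases h : x a ∉ M.closure (x '' (S : Set ι))
    · rw [if_pos h, Matroid.eRk_insert_eq_add_one ⟨by rw [hE]; trivial, h⟩, ih,
        Finset.card_insert_of_notMem (by simp [ha])]
      push_cast; rfl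
    · rw [if_neg h]
      rw [not_not] at h
      rw [← ih, ← M.eRk_insert_closure_eq, Set.insert_eq_of_mem h, M.eRk_closure_eq]

section
variable {L : Type*} [Field L] (K : Subfield L)

/-- algebraic matroid -/
noncomputable abbrev algM : Matroid L := AlgebraicIndependent.matroid K L

lemma mem_algM_closure (X : Set L) (a : L) :
    a ∈ (algM K).closure X ↔ IsAlgebraic (Algebra.adjoin K X) a := by
  rw [AlgebraicIndependent.matroid_closure_eq]; rfl

lemma adjoin_sub_closure (X : Set L) (a : L) (ha : a ∈ IntermediateField.adjoin K X) :
    a ∈ (algM K).closure X := by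
  rw [mem_algM_closure]
  induction ha using IntermediateField.adjoin_induction with
  | mem x hx => exact isAlgebraic_algebraMap (⟨x, Algebra.subset_adjoin hx⟩ : Algebra.adjoin K X)
  | algebraMap x =>
    exact isAlgebraic_algebraMap (algebraMap K (Algebra.adjoin K X) x)
  | add x y _ _ hx hy => exact hx.add hy
  | inv x _ hx => exact hx.inv
  | mul x y _ _ hx hy => exact hx.mul hy

lemma trdeg_of_eRk (X : Set L) (n : ℕ) (h : (algM K).eRk X = n) :
    Algebra.trdeg K (IntermediateField.adjoin K X) = (n : Cardinal) := by
  apply le_antisymm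
  · refine ciSup_le' fun s => ?_
    have h1 : AlgebraicIndepOn K id
        ((IntermediateField.adjoin K X).val '' s.1) := by
      have := s.2.map' (f := (IntermediateField.adjoin K X).val) (Subtype.val_injective)
      have h2 := this.to_subtype_range
      have h3 : Set.range ((IntermediateField.adjoin K X).val ∘ fun i : s.1 => id i.1) =
          (IntermediateField.adjoin K X).val '' s.1 := by
        rw [Set.range_comp]; simp
      rw [h3] at h2
      exact h2
    have h2 : (algM K).Indep ((IntermediateField.adjoin K X).val '' s.1) := h1
    have h3 : ((IntermediateField.adjoin K X).val '' s.1) ⊆ (algM K).closure X := by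
      rintro _ ⟨y, _, rfl⟩
      exact adjoin_sub_closure K X _ y.2
    have h4 := (algM K).eRk_mono h3
    rw [h2.eRk_eq_encard, Matroid.eRk_closure_eq, h,
      Function.Injective.encard_image (f := (IntermediateField.adjoin K X).val) Subtype.val_injective] at h4
    have hfin := Set.finite_of_encard_le_coe h4
    rw [hfin.encard_eq_coe_toFinset_card] at h4
    have h5 : hfin.toFinset.card ≤ n := by exact_mod_cast h4
    have h6 := Set.cast_ncard hfin
    rw [Set.ncard_eq_toFinset_card _ hfin] at h6
    rw [← h6]
    exact_mod_cast h5
  · obtain ⟨I, hI⟩ := (algM K).exists_isBasis X (by simp)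
    have h1 := hI.eRk_eq_encard
    rw [h] at h1
    have hfin : I.Finite := Set.finite_of_encard_eq_coe h1.symm
    let y : I → IntermediateField.adjoin K X := fun i =>
      ⟨i.1, IntermediateField.subset_adjoin _ _ (hI.subset i.2)⟩
    have hy : AlgebraicIndependent K y := by
      have h2 : AlgebraicIndependent K ((↑) : I → L) := hI.indep
      exact AlgebraicIndependent.of_comp (IntermediateField.adjoin K X).val h2
    have h3 := hy.to_subtype_range
    have h4 : Cardinal.mk (Set.range y) = n := by
      rw [Cardinal.mk_range_eq _ hy.injective]
      have h6 := Set.cast_ncard hfin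
      rw [← h6]
      rw [← hfin.cast_ncard_eq] at h1
      exact_mod_cast h1.symm
    rw [← h4]
    exact le_ciSup (f := fun s : { s : Set (IntermediateField.adjoin K X) //
      AlgebraicIndepOn K id s } => Cardinal.mk s.1) Cardinal.bddAbove_of_small ⟨_, h3⟩

lemma closure_transport (g : L ≃+* L) (hg : ∀ x ∈ K, g x ∈ K) (X : Set L) (a : L)
    (ha : a ∈ (algM K).closure X) : g a ∈ (algM K).closure (g '' X) := by
  rw [mem_algM_closure] at ha ⊢
  have hmem : ∀ z : Algebra.adjoin K X, g z ∈ (Algebra.adjoin K (g '' X)).toSubring := by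
    rintro ⟨z, hz⟩
    change g z ∈ Algebra.adjoin K (g '' X)
    induction hz using Algebra.adjoin_induction with
    | mem x hx => exact Algebra.subset_adjoin ⟨x, hx, rfl⟩
    | algebraMap r =>
      exact (Algebra.adjoin K (g '' X)).algebraMap_mem ⟨g r.1, hg _ r.2⟩
    | add x y _ _ hx hy => rw [map_add]; exact add_mem hx hy
    | mul x y _ _ hx hy => rw [map_mul]; exact mul_mem hx hy
  let f : Algebra.adjoin K X →+* Algebra.adjoin K (g '' X) :=
    ((g : L →+* L).comp (Algebra.adjoin K X).subtype).codRestrict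
      (Algebra.adjoin K (g '' X)).toSubring hmem
  refine ha.ringHom_of_comp_eq f (g : L →+* L) ?_ ?_
  · intro a b hab
    have : g a = g b := congrArg Subtype.val hab
    exact Subtype.ext (g.injective this)
  · ext z; rfl

end

/-- The ball in `ℤ^m`. -/
noncomputable def ballZ (m r : ℕ) : Finset (Fin m → ℤ) :=
  (Fintype.piFinset fun _ => Finset.Icc (-(r:ℤ)) r).filter fun k => ∑ i, (k i).natAbs ≤ r

lemma mem_ballZ {m r : ℕ} {k : Fin m → ℤ} : k ∈ ballZ m r ↔ ∑ i, (k i).natAbs ≤ r := by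
  simp only [ballZ, Finset.mem_filter, Fintype.mem_piFinset, Finset.mem_Icc, and_iff_right_iff_imp]
  intro h i
  have := Finset.single_le_sum (f := fun i => (k i).natAbs) (fun i _ => Nat.zero_le _)
    (Finset.mem_univ i)
  omega

/-- Parametrization of the half-open orthants of `ℤ^m`. -/
def emb {m : ℕ} (ε : Fin m → Bool) (v : Fin m → ℕ) : Fin m → ℤ :=
  fun i => if ε i then -1 - (v i : ℤ) else (v i : ℤ)

/-- Left inverse of `emb`. -/
def unemb {m : ℕ} (ε : Fin m → Bool) (k : Fin m → ℤ) : Fin m → ℕ :=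
  fun i => if ε i then (-1 - k i).toNat else (k i).toNat

lemma unemb_emb {m : ℕ} (ε : Fin m → Bool) (v : Fin m → ℕ) : unemb ε (emb ε v) = v := by
  funext i
  simp only [unemb, emb]
  split_ifs <;> omega

lemma emb_unemb {m : ℕ} (ε : Fin m → Bool) (k : Fin m → ℤ) (h : ∀ i, decide (k i < 0) = ε i) :
    emb ε (unemb ε k) = k := by
  funext i
  have := h i
  simp only [unemb, emb]
  split_ifs with h1
  · rw [h1, decide_eq_true_iff] at this; omega
  · rw [Bool.eq_false_iff.2 h1, decide_eq_false_iff_not] at this; omega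

lemma sign_emb {m : ℕ} (ε : Fin m → Bool) (v : Fin m → ℕ) (i : Fin m) :
    decide (emb ε v i < 0) = ε i := by
  simp only [emb]
  split_ifs with h1
  · rw [h1, decide_eq_true_iff]; omega
  · rw [Bool.eq_false_iff.2 h1, decide_eq_false_iff_not]; omega

lemma ord_emb {m : ℕ} (ε : Fin m → Bool) (v : Fin m → ℕ) :
    ∑ i, (emb ε v i).natAbs = ∑ i, v i + ∑ i, (if ε i then 1 else 0) := by
  rw [← Finset.sum_add_distrib]
  refine Finset.sum_congr rfl fun i _ => ?_
  simp only [emb]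
  split_ifs <;> omega

open Classical in
lemma ball_EP {m : ℕ} (A : Set (Fin m → ℤ))
    (hA : ∀ k h : Fin m → ℤ, (∀ i, (k i + h i).natAbs = (k i).natAbs + (h i).natAbs) →
      k ∈ A → k + h ∈ A) :
    EP m (∑ ε : Fin m → Bool, if {v | emb ε v ∈ A} = ∅ then 1 else 0)
      (fun r => (((ballZ m r).filter fun k => k ∉ A).card : ℤ)) := by
  have h1 : ∀ r, (((ballZ m r).filter fun k => k ∉ A).card : ℤ) =
      ∑ ε : Fin m → Bool, ((((ballZ m r).filter fun k => k ∉ A).filter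
        fun k => (fun i => decide (k i < 0)) = ε).card : ℤ) := by
    intro r
    rw [Finset.card_eq_sum_card_fiberwise (f := fun (k : Fin m → ℤ) i => decide (k i < 0))
      (t := Finset.univ) (by intro; simp)]
    push_cast
    rfl
  simp only [h1]
  refine EP.sum _ fun ε _ => ?_
  have hup : IsUpperSet {v | emb ε v ∈ A} := by
    intro v w hvw hv
    have := hA (emb ε v) (fun i => if ε i then -((w i - v i : ℕ) : ℤ) else ((w i - v i : ℕ) : ℤ))
      (fun i => by simp only [emb]; split_ifs <;> omega) hv
    have h2 : emb ε v + (fun i => if ε i then -((w i - v i : ℕ) : ℤ) else ((w i - v i : ℕ) : ℤ))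
        = emb ε w := by
      funext i
      have : v i ≤ w i := hvw i
      simp only [emb, Pi.add_apply]
      split_ifs <;> omega
    rw [h2] at this
    exact this
  refine EP.unshift (∑ i, (if ε i then 1 else 0)) ((cnt_EP _ hup).congr 0 fun r _ => ?_)
  unfold cnt
  congr 1
  refine Finset.card_nbij' (emb ε) (unemb ε) ?_ ?_ ?_ ?_
  · intro v hv
    simp only [Finset.coe_filter, Set.mem_ofPred_eq, Finset.mem_filter, mem_box, mem_ballZ] at hv ⊢
    refine ⟨⟨?_, hv.2⟩, funext (sign_emb ε v)⟩
    rw [ord_emb]; omega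
  · intro k hk
    simp only [Finset.coe_filter, Set.mem_ofPred_eq, Finset.mem_filter, mem_box, mem_ballZ] at hk ⊢
    obtain ⟨⟨h2, h3⟩, h4⟩ := hk
    have h5 := emb_unemb ε k (congrFun h4)
    rw [h5]
    refine ⟨?_, h3⟩
    rw [← h5, ord_emb] at h2
    omega
  · intro v _
    exact unemb_emb ε v
  · intro k hk
    simp only [Finset.coe_filter, Set.mem_ofPred_eq, Finset.mem_filter] at hk
    exact emb_unemb ε k (congrFun hk.2)

/-- the ranking on terms -/
def rkey {m s : ℕ} (p : (Fin m → ℤ) × Fin s) : ℕ ×ₗ (Fin s ×ₗ Lex (Fin m → ℤ)) :=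
  toLex (∑ i, (p.1 i).natAbs, toLex (p.2, toLex p.1))

lemma rkey_inj {m s : ℕ} : Function.Injective (rkey (m := m) (s := s)) := by
  intro p q h
  have h1 := congrArg (fun z => (ofLex (ofLex z).2)) h
  have h2 := congrArg (fun z => z.1) h1
  have h3 := congrArg (fun z => ofLex z.2) h1
  exact Prod.ext h3 h2

lemma rkey_ord {m s : ℕ} {p q : (Fin m → ℤ) × Fin s} (h : rkey p < rkey q) :
    ∑ i, (p.1 i).natAbs ≤ ∑ i, (q.1 i).natAbs := by
  rw [rkey, rkey, Prod.Lex.toLex_lt_toLex] at h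
  rcases h with h | h
  · exact h.le
  · exact h.1.le

lemma rkey_shift {m s : ℕ} {p q : (Fin m → ℤ) × Fin s} (h : rkey p < rkey q) (e : Fin m → ℤ)
    (he : ∀ i, (q.1 i + e i).natAbs = (q.1 i).natAbs + (e i).natAbs) :
    rkey (p.1 + e, p.2) < rkey (q.1 + e, q.2) := by
  have h1 : ∑ i, (p.1 i + e i).natAbs ≤ ∑ i, (p.1 i).natAbs + ∑ i, (e i).natAbs := by
    rw [← Finset.sum_add_distrib]
    exact Finset.sum_le_sum fun i _ => Int.natAbs_add_le _ _
  have h2 : ∑ i, (q.1 i + e i).natAbs = ∑ i, (q.1 i).natAbs + ∑ i, (e i).natAbs := by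
    rw [← Finset.sum_add_distrib]
    exact Finset.sum_congr rfl fun i _ => he i
  rw [rkey, rkey, Prod.Lex.toLex_lt_toLex] at h ⊢
  simp only [Pi.add_apply]
  rw [h2]
  rcases h with h | ⟨h, h'⟩
  · left; simp only at h; omega
  · simp only at h h'
    rcases (show ∑ i, (p.1 i + e i).natAbs ≤ ∑ i, (q.1 i).natAbs + ∑ i, (e i).natAbs by
      omega).lt_or_eq with h3 | h3
    · left; exact h3
    · right
      refine ⟨h3, ?_⟩
      rw [Prod.Lex.toLex_lt_toLex] at h' ⊢
      rcases h' with h' | ⟨h', h''⟩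
      · left; exact h'
      · right
        refine ⟨h', ?_⟩
        exact add_lt_add_left (α := Lex (Fin m → ℤ)) h'' (toLex e)

section main
variable {L : Type*} [Field L] {m s : ℕ} (K : Subfield L)

open Classical in
theorem core (G : (Fin m → ℤ) → RingAut L)
    (hG : ∀ k h, G (k + h) = G h * G k) (hK : ∀ k, ∀ x ∈ K, G k x ∈ K) (η : Fin s → L) :
    ∃ (f : ℕ → ℕ) (a : ℤ), EP m (2 ^ m * a) (fun r => (f r : ℤ)) ∧
      ∀ r, (algM K).eRk {x : L | ∃ k : Fin m → ℤ, (∑ i, (k i).natAbs) ≤ r ∧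
              ∃ j : Fin s, x = G k (η j)} = (f r : ℕ∞) := by
  let x : (Fin m → ℤ) × Fin s → L := fun p => G p.1 (η p.2)
  have hx : ∀ p h, G h (x p) = x (p.1 + h, p.2) := by
    intro p h
    simp only [x, hG]; rfl
  let M := algM K
  let A : Fin s → Set (Fin m → ℤ) := fun j =>
    {k | x (k, j) ∈ M.closure (x '' {p | rkey p < rkey (k, j)})}
  have hA : ∀ j, ∀ k h : Fin m → ℤ, (∀ i, (k i + h i).natAbs = (k i).natAbs + (h i).natAbs) →
      k ∈ A j → k + h ∈ A j := by
    intro j k h hh hk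
    have h1 := closure_transport K (G h) (hK h) _ _ hk
    rw [hx] at h1
    refine M.closure_subset_closure ?_ h1
    rintro _ ⟨_, ⟨p, hp, rfl⟩, rfl⟩
    rw [hx]
    exact ⟨_, rkey_shift hp h hh, rfl⟩
  let S : ℕ → Finset ((Fin m → ℤ) × Fin s) := fun r => ballZ m r ×ˢ Finset.univ
  let f : ℕ → ℕ := fun r => ∑ j, ((ballZ m r).filter fun k => k ∉ A j).card
  have hfr : ∀ r, M.eRk (x '' (S r : Set _)) = (f r : ℕ∞) := by
    intro r
    rw [rk_count M rfl x rkey rkey_inj]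
    congr 1
    have h1 : (S r).filter (fun i => x i ∉ M.closure (x '' {j | j ∈ S r ∧ rkey j < rkey i})) =
        (S r).filter (fun p => p.1 ∉ A p.2) := by
      refine Finset.filter_congr fun p hp => ?_
      have : {j | j ∈ S r ∧ rkey j < rkey p} = {j | rkey j < rkey p} := by
        ext q
        simp only [Set.mem_ofPred_eq, and_iff_right_iff_imp]
        intro hq
        have := rkey_ord hq
        simp only [S, Finset.mem_product, mem_ballZ, Finset.mem_univ, and_true] at hp ⊢
        omega
      rw [this]
      rfl
    rw [h1, Finset.card_eq_sum_card_fiberwise (f := fun p => p.2) (t := Finset.univ)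
      (by intro; simp)]
    refine Finset.sum_congr rfl fun j _ => ?_
    refine Finset.card_nbij' (fun p => p.1) (fun k => (k, j)) ?_ ?_ ?_ ?_
    · rintro ⟨k, j'⟩ hp
      simp only [S, Finset.coe_filter, Set.mem_ofPred_eq, Finset.mem_filter, Finset.mem_product] at hp ⊢
      obtain ⟨⟨h2, h3⟩, rfl⟩ := hp
      exact ⟨h2.1, h3⟩
    · intro k hk
      simp only [S, Finset.coe_filter, Set.mem_ofPred_eq, Finset.mem_filter, Finset.mem_product] at hk ⊢
      exact ⟨⟨⟨hk.1, Finset.mem_univ _⟩, hk.2⟩, trivial⟩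
    · rintro ⟨k, j'⟩ hp
      simp only [Finset.coe_filter, Set.mem_ofPred_eq, Finset.mem_filter] at hp
      rw [← hp.2]
    · intro k _; rfl
  have hEP : EP m (∑ j, ∑ ε : Fin m → Bool, if {v | emb ε v ∈ A j} = ∅ then 1 else 0)
      (fun r => (f r : ℤ)) := by
    have := EP.sum Finset.univ fun j (_ : j ∈ Finset.univ) => ball_EP (A j) (hA j)
    refine this.congr 0 fun r _ => ?_
    simp only [f]; push_cast; rfl
  let T : (Fin m → Bool) → Finset (Fin s) := fun ε =>
    Finset.univ.filter fun j => {v | emb ε v ∈ A j} = ∅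
  have hc : (∑ j, ∑ ε : Fin m → Bool, if {v | emb ε v ∈ A j} = ∅ then (1:ℤ) else 0) =
      ∑ ε, ((T ε).card : ℤ) := by
    rw [Finset.sum_comm]
    refine Finset.sum_congr rfl fun ε _ => ?_
    simp [T]
  rw [hc] at hEP
  have hball : EP m (2 ^ m) (fun r => ((ballZ m r).card : ℤ)) := by
    have := ball_EP (m := m) ∅ (by simp)
    simpa using this
  have hlow : ∀ ε r, ((ballZ m r).card * (T ε).card) ≤ f r := by
    intro ε r
    let h : Fin m → ℤ := fun i => if ε i then -((r:ℤ)+1) else r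
    let F : (Fin m → ℤ) × Fin s → ℕ ×ₗ (Fin s ×ₗ Lex (Fin m → ℤ)) := fun p => rkey (p.1 + h, p.2)
    have hF : Function.Injective F := by
      intro p q hpq
      have := rkey_inj hpq
      simp only [Prod.mk.injEq, add_left_inj] at this
      exact Prod.ext this.1 this.2
    have h1 := rk_count M rfl x F hF (ballZ m r ×ˢ T ε)
    rw [Finset.filter_true_of_mem, Finset.card_product] at h1
    · have h2 : M.eRk (x '' ((ballZ m r ×ˢ T ε : Finset _) : Set _)) ≤ M.eRk (x '' (S r : Set _)) := by
        refine M.eRk_mono (Set.image_mono ?_)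
        simp only [S, Finset.coe_subset]
        exact Finset.product_subset_product_right (Finset.subset_univ _)
      rw [h1, hfr] at h2
      exact_mod_cast h2
    · rintro ⟨k, j⟩ hp hcl
      simp only [Finset.mem_product, mem_ballZ, T, Finset.mem_filter, Finset.mem_univ, true_and] at hp
      obtain ⟨hk, hj⟩ := hp
      have h2 : k + h ∈ A j := by
        have h3 := closure_transport K (G h) (hK h) _ _ hcl
        rw [hx] at h3
        refine M.closure_subset_closure ?_ h3
        rintro _ ⟨_, ⟨p, hp, rfl⟩, rfl⟩
        rw [hx]
        exact ⟨_, hp.2, rfl⟩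
      have h4 : emb ε (unemb ε (k + h)) = k + h := by
        refine emb_unemb _ _ fun i => ?_
        have := Finset.single_le_sum (f := fun i => (k i).natAbs) (fun i _ => Nat.zero_le _)
          (Finset.mem_univ i)
        simp only [Pi.add_apply, h] at this ⊢
        split_ifs with h5
        · rw [h5, decide_eq_true_iff]; omega
        · rw [Bool.eq_false_iff.2 h5, decide_eq_false_iff_not]; omega
      have : unemb ε (k + h) ∈ {v | emb ε v ∈ A j} := by
        change emb ε _ ∈ A j
        rw [h4]; exact h2
      rw [hj] at this
      exact this
  have hcle : ∀ ε, 2 ^ m * ((T ε).card : ℤ) ≤ ∑ ε, ((T ε).card : ℤ) := by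
    intro ε
    have h1 := EP.sum (T ε) fun j (_ : j ∈ T ε) => hball
    refine (show (2 ^ m * ((T ε).card : ℤ)) = ∑ j ∈ T ε, 2 ^ m by simp [mul_comm]) ▸
      h1.le hEP fun r => ?_
    have := hlow ε r
    simp only [Finset.sum_const, nsmul_eq_mul]
    rw [mul_comm]
    exact_mod_cast this
  obtain ⟨ε0, _, hmax⟩ := Finset.exists_max_image Finset.univ (fun ε => (T ε).card)
    (Finset.univ_nonempty)
  have hceq : ∑ ε, ((T ε).card : ℤ) = 2 ^ m * ((T ε0).card : ℤ) := by
    refine le_antisymm ?_ (hcle ε0)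
    refine (Finset.sum_le_card_nsmul _ _ ((T ε0).card : ℤ) fun ε hε => ?_).trans ?_
    · exact_mod_cast hmax ε hε
    · simp
  rw [hceq] at hEP
  refine ⟨f, (T ε0).card, hEP, fun r => ?_⟩
  rw [← hfr r]
  congr 1
  ext z
  simp only [Set.mem_ofPred_eq, Set.mem_image, S, Finset.mem_coe, Finset.mem_product, mem_ballZ,
    Finset.mem_univ, and_true, x]
  constructor
  · rintro ⟨k, hk, j, rfl⟩
    exact ⟨(k, j), hk, rfl⟩
  · rintro ⟨⟨k, j⟩, hk, rfl⟩
    exact ⟨k, hk, j, rfl⟩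
end main

/-- `gammaApply` as an automorphism -/
def gam {L : Type*} [Field L] {m : ℕ} (σ : Fin m → RingAut L) (k : Fin m → ℤ) : RingAut L :=
  (List.ofFn fun i => σ i ^ k i).prod

lemma gammaApply_eq {L : Type*} [Field L] {m : ℕ} (σ : Fin m → RingAut L) (k : Fin m → ℤ) :
    gammaApply σ k = ⇑(gam σ k) := by
  induction m with
  | zero => simp [gammaApply, gam]
  | succ m ih =>
    have := ih (fun i => σ i.succ) (fun i => k i.succ)
    simp only [gammaApply, gam, List.ofFn_succ, List.foldr_cons, List.prod_cons] at this ⊢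
    rw [this]
    rfl

lemma gam_add {L : Type*} [Field L] {m : ℕ} (σ : Fin m → RingAut L)
    (hcomm : ∀ i j, σ i * σ j = σ j * σ i) (k h : Fin m → ℤ) :
    gam σ (k + h) = gam σ k * gam σ h := by
  induction m with
  | zero => simp [gam]
  | succ m ih =>
    have h1 := ih (fun i => σ i.succ) (fun i j => hcomm _ _) (fun i => k i.succ) (fun i => h i.succ)
    have h2 : Commute (σ 0 ^ h 0) (gam (fun i => σ i.succ) (fun i => k i.succ)) := by
      refine Commute.list_prod_right _ _ fun y hy => ?_
      rw [List.mem_ofFn] at hy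
      obtain ⟨i, rfl⟩ := hy
      exact (show Commute (σ 0) (σ i.succ) from hcomm _ _).zpow_zpow _ _
    simp only [gam, List.ofFn_succ, List.prod_cons] at h1 h2 ⊢
    have h3 : (fun i : Fin m => σ i.succ ^ (k + h) i.succ) =
      fun i : Fin m => σ i.succ ^ ((fun i => k (Fin.succ i)) + (fun i => h (Fin.succ i))) i := rfl
    rw [h3, h1, Pi.add_apply, zpow_add]
    simp only [mul_assoc]
    congr 1
    rw [← mul_assoc, h2.eq, mul_assoc]

lemma gam_mem {L : Type*} [Field L] {m : ℕ} (σ : Fin m → RingAut L)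
    (K : Subfield L) (hK : ∀ i, ∀ x ∈ K, σ i x ∈ K)
    (hK' : ∀ i, ∀ x ∈ K, (σ i)⁻¹ x ∈ K) (k : Fin m → ℤ) : ∀ x ∈ K, gam σ k x ∈ K := by
  have hn : ∀ (g : RingAut L), (∀ x ∈ K, g x ∈ K) → ∀ n : ℕ, ∀ x ∈ K, (g ^ n) x ∈ K := by
    intro g hg n
    induction n with
    | zero => intro x hx; simpa using hx
    | succ n ih => intro x hx; rw [pow_succ]; exact ih _ (hg x hx)
  induction m with
  | zero => intro x hx; simpa [gam] using hx
  | succ m ih =>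
    intro x hx
    have := ih (fun i => σ i.succ) (fun i => hK _) (fun i => hK' _) (fun i => k i.succ) x hx
    simp only [gam, List.ofFn_succ, List.prod_cons] at this ⊢
    rw [RingAut.mul_apply]
    obtain ⟨n, h | h⟩ := (k 0).eq_nat_or_neg
    · rw [h, zpow_natCast]; exact hn _ (hK 0) n _ this
    · rw [h, zpow_neg, zpow_natCast, ← inv_pow]; exact hn _ (hK' 0) n _ this

/-- Existence of the inversive difference dimension polynomial (Theorem III.4):
there is a polynomial `ψ ∈ ℚ[t]` with `deg ψ ≤ m`, of the form
`ψ(t) = (2^m a / m!) t^m + (lower degree terms)` for an integer `a`, whose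
value at all sufficiently large `r` is the transcendence degree over `K` of the
field obtained from `K` by adjoining all `γ_k(η_j)` with `ord γ_k ≤ r`. -/
theorem inversive_difference_dimension_polynomial_exists
    (L : Type*) [Field L] (m s : ℕ) (hm : 1 ≤ m) (hs : 1 ≤ s)
    (σ : Fin m → RingAut L)
    (hcomm : ∀ i j, σ i * σ j = σ j * σ i)
    (K : Subfield L) (hK : ∀ i, ∀ x ∈ K, σ i x ∈ K)
    (hK' : ∀ i, ∀ x ∈ K, (σ i)⁻¹ x ∈ K)
    (η : Fin s → L) :
    ∃ (ψ : Polynomial ℚ) (a : ℤ),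
      ψ.degree ≤ m ∧
      ψ.coeff m = 2 ^ m * (a : ℚ) / (m.factorial : ℚ) ∧
      ∃ N : ℕ, ∀ r : ℕ, N ≤ r → ∃ d : ℕ,
        trdeg ↥K ↥(IntermediateField.adjoin ↥K
            {x : L | ∃ k : Fin m → ℤ, (∑ i, (k i).natAbs) ≤ r ∧
              ∃ j : Fin s, x = gammaApply σ k (η j)}) = (d : Cardinal) ∧
        ψ.eval (r : ℚ) = (d : ℚ) := by
  obtain ⟨f, a, hEP, hrk⟩ := core K (gam σ)
    (fun k h => by rw [add_comm, gam_add σ hcomm]) (gam_mem σ K hK hK') η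
  obtain ⟨ψ, hdeg, hcoeff, N, hN⟩ := hEP.poly
  refine ⟨ψ, a, hdeg, ?_, N, fun r hr => ⟨f r, ?_, ?_⟩⟩
  · rw [hcoeff]; push_cast; rfl
  · refine trdeg_of_eRk K _ _ ?_
    rw [← hrk r]
    congr 1
    ext z
    simp only [gammaApply_eq]
  · rw [hN r hr]; simp
end
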